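/- With s ≥ 3456·ln(4/δ)/ε² i.i.d. samples S = (θ_1,…,θ_s) from a distribution D over agent types, with probability at least 1−δ, simultaneously for all α ∈ [0,1]: |U_p(D,α) − U_p(S,α)| ≤ ε (uniform convergence for linear contracts). -/

import Mathlib

open Finset MeasureTheory

namespace UCLC

noncomputable def sg (b : Bool) : ℝ := if b then 1 else -1

lemma sg_not (b : Bool) : sg (!b) = - sg b := by cases b <;> simp [sg]

lemma abs_sg (b : Bool) : |sg b| = 1 := by cases b <;> simp [sg]

lemma map_psups (φ : ℝ → ℝ) (hφ : Monotone φ) (a : ℕ → ℝ) (N : ℕ) :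
    φ (partialSups a N) = partialSups (fun k => φ (a k)) N := by
  induction N with
  | zero => simp
  | succ k ih => rw [partialSups_add_one, partialSups_add_one, ← ih, hφ.map_sup]

variable {ι : Type*} [Fintype ι] [DecidableEq ι]

def flip (B : Finset ι) (σ : ι → Bool) : ι → Bool := fun i => if i ∈ B then !(σ i) else σ i

lemma flip_invol (B : Finset ι) : Function.Involutive (flip B) := by
  intro σ; funext i; by_cases h : i ∈ B <;> simp [flip, h]

lemma sum_flip (B : Finset ι) (F : (ι → Bool) → ℝ) :
    ∑ σ, F (flip B σ) = ∑ σ, F σ :=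
  Equiv.sum_comp (flip_invol B).toPerm F

lemma le_sum_flip (B : Finset ι) (h : (ι → Bool) → ℝ) (h0 : ∀ σ, 0 ≤ h σ)
    (hB : ∀ σ, h (flip B σ) = h σ) (c : ℝ) :
    ∑ σ, h σ ≤ ∑ σ, h σ * Real.exp (c * ∑ i ∈ B, sg (σ i)) := by
  have e1 := sum_flip B (fun σ => h σ * Real.exp (c * ∑ i ∈ B, sg (σ i)))
  have e2 : ∀ σ, ∑ i ∈ B, sg (flip B σ i) = - ∑ i ∈ B, sg (σ i) := by
    intro σ
    rw [← Finset.sum_neg_distrib]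
    refine Finset.sum_congr rfl fun i hi => ?_
    simp [flip, hi, sg_not]
  simp only [hB, e2] at e1
  have : ∑ σ, (h σ + h σ) ≤ ∑ σ, (h σ * Real.exp (c * -∑ i ∈ B, sg (σ i)) +
      h σ * Real.exp (c * ∑ i ∈ B, sg (σ i))) := by
    refine Finset.sum_le_sum fun σ _ => ?_
    set x := c * ∑ i ∈ B, sg (σ i)
    have : c * -∑ i ∈ B, sg (σ i) = -x := by simp [x]
    rw [this]
    have h1 := Real.one_le_cosh x
    rw [Real.cosh_eq] at h1
    nlinarith [h0 σ]
  rw [Finset.sum_add_distrib, Finset.sum_add_distrib, e1] at this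
  linarith

lemma sum_exp (A : Finset ι) (τ : ℝ) :
    ∑ σ : ι → Bool, Real.exp (τ * ∑ i ∈ A, sg (σ i)) ≤
      2 ^ Fintype.card ι * Real.exp (τ ^ 2 * Fintype.card ι / 2) := by
  have h1 : ∀ σ : ι → Bool, Real.exp (τ * ∑ i ∈ A, sg (σ i)) =
      ∏ i, Real.exp (if i ∈ A then τ * sg (σ i) else 0) := by
    intro σ
    rw [← Real.exp_sum, Finset.mul_sum, Finset.sum_ite_mem, Finset.univ_inter]
  simp only [h1]
  have h2 := Finset.prod_univ_sum (fun _ : ι => (Finset.univ : Finset Bool))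
    (fun i b => Real.exp (if i ∈ A then τ * sg b else 0))
  rw [Fintype.piFinset_univ] at h2
  rw [← h2]
  have h3 : ∏ i : ι, ∑ b : Bool, Real.exp (if i ∈ A then τ * sg b else 0) ≤
      ∏ i : ι, (2 * Real.exp (τ ^ 2 / 2)) := by
    refine Finset.prod_le_prod (fun i _ => Finset.sum_nonneg fun b _ => (Real.exp_pos _).le) ?_
    intro i _
    by_cases hi : i ∈ A
    · have := Real.cosh_le_exp_half_sq τ
      rw [Real.cosh_eq] at this
      simp [hi, sg]
      linarith
    · have := Real.one_le_exp (x := τ ^ 2 / 2) (by positivity)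
      simp only [hi, if_false, Real.exp_zero, Finset.sum_const, Finset.card_univ, Fintype.card_bool, nsmul_eq_mul]
      push_cast
      linarith
  refine h3.trans (le_of_eq ?_)
  rw [Finset.prod_const, Finset.card_univ, mul_pow, ← Real.exp_nat_mul]
  ring_nf

lemma doob (A : ℕ → Finset ι) (hA : Monotone A) (c : ℝ) (N : ℕ) :
    ∑ σ : ι → Bool, (2 * (partialSups (fun k => Real.exp (c * ∑ i ∈ A k, sg (σ i))) N) ^ 2
      - 4 * Real.exp (c * ∑ i ∈ A N, sg (σ i)) *
        partialSups (fun k => Real.exp (c * ∑ i ∈ A k, sg (σ i))) N) ≤ 0 := by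
  induction N with
  | zero =>
    refine Finset.sum_nonpos fun σ _ => ?_
    simp only [partialSups_zero]
    nlinarith [sq_nonneg (Real.exp (c * ∑ i ∈ A 0, sg (σ i)))]
  | succ N ih =>
    set m : ℕ → (ι → Bool) → ℝ := fun k σ => Real.exp (c * ∑ i ∈ A k, sg (σ i)) with hm
    set M : (ι → Bool) → ℝ := fun σ => partialSups (fun k => m k σ) N with hM
    have key : ∑ σ, m N σ * M σ ≤ ∑ σ, m (N+1) σ * M σ := by
      set B := A (N+1) \ A N with hB
      have hflip : ∀ k ≤ N, ∀ σ, m k (flip B σ) = m k σ := by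
        intro k hk σ
        simp only [hm]
        congr 2
        refine Finset.sum_congr rfl fun i hi => ?_
        have : i ∉ B := by
          simp only [hB, Finset.mem_sdiff, not_and, not_not]
          exact fun _ => hA hk hi
        simp [flip, this]
      have hMflip : ∀ σ, M (flip B σ) = M σ := by
        intro σ
        apply le_antisymm
        · refine partialSups_le _ _ _ fun j hj => ?_
          rw [hflip j hj]; exact le_partialSups_of_le (fun k => m k σ) hj
        · refine partialSups_le _ _ _ fun j hj => ?_
          rw [← hflip j hj]; exact le_partialSups_of_le (fun k => m k (flip B σ)) hj
      have hM0 : ∀ σ, 0 ≤ M σ := fun σ =>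
        (Real.exp_pos _).le.trans (le_partialSups_of_le (fun k => m k σ) le_rfl)
      have := le_sum_flip B (fun σ => m N σ * M σ)
        (fun σ => mul_nonneg (Real.exp_pos _).le (hM0 σ))
        (fun σ => by simp only [hflip N le_rfl, hMflip]) c
      refine this.trans (le_of_eq (Finset.sum_congr rfl fun σ _ => ?_))
      have : m (N+1) σ = m N σ * Real.exp (c * ∑ i ∈ B, sg (σ i)) := by
        simp only [hm]
        rw [← Real.exp_add, ← mul_add, hB, ← Finset.sum_sdiff (hA (Nat.le_succ N)),
          add_comm]
      rw [this]; ring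
    have hle : ∑ σ, (2 * (partialSups (fun k => m k σ) (N+1)) ^ 2
        - 4 * m (N+1) σ * partialSups (fun k => m k σ) (N+1)) ≤
        ∑ σ, (2 * M σ ^ 2 - 4 * (m (N+1) σ * M σ)) := by
      refine Finset.sum_le_sum fun σ _ => ?_
      rw [partialSups_add_one]
      change 2 * (max (M σ) (m (N+1) σ)) ^ 2 - 4 * m (N+1) σ * (max (M σ) (m (N+1) σ)) ≤ _
      rcases max_cases (M σ) (m (N+1) σ) with ⟨h, _⟩ | ⟨h, _⟩
      · rw [h]; linarith
      · rw [h]; nlinarith [sq_nonneg (M σ - m (N+1) σ)]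
    refine hle.trans (le_trans ?_ ih)
    change _ ≤ ∑ σ, (2 * M σ ^ 2 - 4 * m N σ * M σ)
    simp only [mul_assoc]
    rw [Finset.sum_sub_distrib, Finset.sum_sub_distrib, ← Finset.mul_sum, ← Finset.mul_sum (f := fun σ => m (N+1) σ * M σ), ← Finset.mul_sum (f := fun σ => m N σ * M σ)]
    linarith

lemma chain_sets (A : ℕ → Finset ι) (hA : Monotone A) (τ : ℝ) (hτ : 0 ≤ τ) (N : ℕ) :
    ∑ σ : ι → Bool, Real.exp (τ * partialSups (fun k => ∑ i ∈ A k, sg (σ i)) N) ≤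
      2 ^ Fintype.card ι * (4 * Real.exp (τ ^ 2 * Fintype.card ι / 2)) := by
  have h1 := doob A hA (τ / 2) N
  have h2 := sum_exp (A N) τ
  have h3 : ∑ σ : ι → Bool, Real.exp (τ * partialSups (fun k => ∑ i ∈ A k, sg (σ i)) N) ≤
     ∑ σ : ι → Bool, ((2 * (partialSups (fun k => Real.exp (τ / 2 * ∑ i ∈ A k, sg (σ i))) N) ^ 2
      - 4 * Real.exp (τ / 2 * ∑ i ∈ A N, sg (σ i)) *
        partialSups (fun k => Real.exp (τ / 2 * ∑ i ∈ A k, sg (σ i))) N) +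
        4 * Real.exp (τ * ∑ i ∈ A N, sg (σ i))) := by
    refine Finset.sum_le_sum fun σ _ => ?_
    have e1 := map_psups (fun x => Real.exp (τ / 2 * x))
      (fun a b h => Real.exp_le_exp.2 (mul_le_mul_of_nonneg_left h (by positivity)))
      (fun k => ∑ i ∈ A k, sg (σ i)) N
    rw [← e1]
    have sq : ∀ x, Real.exp (τ * x) = Real.exp (τ / 2 * x) ^ 2 := by
      intro x; rw [← Real.exp_nat_mul]; congr 1; push_cast; ring
    rw [sq, sq]
    nlinarith [sq_nonneg (2 * Real.exp (τ / 2 * ∑ i ∈ A N, sg (σ i)) -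
      Real.exp (τ / 2 * partialSups (fun k => ∑ i ∈ A k, sg (σ i)) N))]
  have h4 : ∑ σ : ι → Bool, 4 * Real.exp (τ * ∑ i ∈ A N, sg (σ i)) =
      4 * ∑ σ : ι → Bool, Real.exp (τ * ∑ i ∈ A N, sg (σ i)) := by rw [Finset.mul_sum]
  rw [Finset.sum_add_distrib, h4] at h3
  linarith

lemma measurable_psups {Ω : Type*} [MeasurableSpace Ω] (Y : ℕ → Ω → ℝ)
    (hY : ∀ k, Measurable (Y k)) (N : ℕ) :
    Measurable fun ω => partialSups (fun k => Y k ω) N := by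
  induction N with
  | zero => simpa using hY 0
  | succ N ih => simp only [partialSups_add_one]; exact ih.sup (hY _)

lemma abs_psups_le (a : ℕ → ℝ) (C : ℝ) (h : ∀ k, |a k| ≤ C) (N : ℕ) :
    |partialSups a N| ≤ C :=
  abs_le.2 ⟨(abs_le.1 (h N)).1.trans (le_partialSups_of_le a le_rfl),
    partialSups_le _ _ _ fun j _ => (abs_le.1 (h j)).2⟩

lemma integrable_exp_psups {Ω : Type*} [MeasurableSpace Ω] (ν : Measure Ω) [IsFiniteMeasure ν]
    (Y : ℕ → Ω → ℝ) (hY : ∀ k, Measurable (Y k)) (C : ℝ) (hC : ∀ k ω, |Y k ω| ≤ C)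
    (τ : ℝ) (hτ : 0 ≤ τ) (N : ℕ) :
    Integrable (fun ω => Real.exp (τ * partialSups (fun k => Y k ω) N)) ν := by
  refine Integrable.of_bound
    (Real.measurable_exp.comp ((measurable_psups Y hY N).const_mul τ)).aestronglyMeasurable
    (Real.exp (τ * C)) (Filter.Eventually.of_forall fun ω => ?_)
  rw [Real.norm_eq_abs, Real.abs_exp]
  exact Real.exp_le_exp.2 (mul_le_mul_of_nonneg_left
    ((le_abs_self _).trans (abs_psups_le _ C (fun k => hC k ω) N)) hτ)

lemma jensen {Ω : Type*} [MeasurableSpace Ω] (ν : Measure Ω) [IsProbabilityMeasure ν]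
    (Y : ℕ → Ω → ℝ) (hY : ∀ k, Measurable (Y k)) (C : ℝ) (hC : ∀ k ω, |Y k ω| ≤ C)
    (τ : ℝ) (hτ : 0 ≤ τ) (N : ℕ) :
    Real.exp (τ * partialSups (fun k => ∫ ω, Y k ω ∂ν) N) ≤
      ∫ ω, Real.exp (τ * partialSups (fun k => Y k ω) N) ∂ν := by
  have hi : Integrable (fun ω => partialSups (fun k => Y k ω) N) ν :=
    Integrable.of_bound (measurable_psups Y hY N).aestronglyMeasurable C
      (Filter.Eventually.of_forall fun ω => abs_psups_le _ C (fun k => hC k ω) N)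
  have h1 : partialSups (fun k => ∫ ω, Y k ω ∂ν) N ≤ ∫ ω, partialSups (fun k => Y k ω) N ∂ν := by
    refine partialSups_le _ _ _ fun j hj => ?_
    refine integral_mono (Integrable.of_bound (hY j).aestronglyMeasurable C
      (Filter.Eventually.of_forall fun ω => hC j ω)) hi fun ω => ?_
    exact le_partialSups_of_le (fun k => Y k ω) hj
  have h2 := convexOn_exp.map_integral_le (μ := ν)
    (f := fun ω => τ * partialSups (fun k => Y k ω) N)
    Real.continuous_exp.continuousOn isClosed_univ (by simp) (hi.const_mul τ)
    (integrable_exp_psups ν Y hY C hC τ hτ N)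
  refine le_trans (Real.exp_le_exp.2 ?_) h2
  rw [integral_const_mul]
  exact mul_le_mul_of_nonneg_left h1 hτ

lemma chain_vec (v : ℕ → ι → ℝ) (hv : Monotone v) (h01 : ∀ k i, v k i ∈ Set.Icc (0:ℝ) 1)
    (τ : ℝ) (hτ : 0 ≤ τ) (N : ℕ) :
    ∑ σ : ι → Bool, Real.exp (τ * partialSups (fun k => ∑ i, sg (σ i) * v k i) N) ≤
      2 ^ Fintype.card ι * (4 * Real.exp (τ ^ 2 * Fintype.card ι / 2)) := by
  classical
  let ν : Measure ℝ := volume.restrict (Set.Ico 0 1)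
  have : IsProbabilityMeasure ν := ⟨by simp [ν]⟩
  let A : ℝ → ℕ → Finset ι := fun t k => Finset.univ.filter fun i => t < v k i
  have hA : ∀ t, Monotone (A t) := by
    intro t k l hkl i hi
    simp only [A, Finset.mem_filter, Finset.mem_univ, true_and] at hi ⊢
    exact hi.trans_le (hv hkl i)
  let Y : (ι → Bool) → ℕ → ℝ → ℝ := fun σ k t => ∑ i ∈ A t k, sg (σ i)
  have hYe : ∀ σ k t, Y σ k t = ∑ i, sg (σ i) * (Set.Iio (v k i)).indicator (fun _ => (1:ℝ)) t := by
    intro σ k t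
    simp only [Y, A, Finset.sum_filter, Set.indicator_apply, Set.mem_Iio, mul_ite, mul_one, mul_zero]
  have hind : ∀ k i, Measurable ((Set.Iio (v k i)).indicator (fun _ => (1:ℝ))) := fun k i =>
    measurable_const.indicator measurableSet_Iio
  have hYm : ∀ σ k, Measurable (Y σ k) := by
    intro σ k
    rw [show Y σ k = _ from funext (hYe σ k)]
    exact Finset.measurable_sum _ fun i _ => (hind k i).const_mul _
  have hYb : ∀ σ k t, |Y σ k t| ≤ Fintype.card ι := by
    intro σ k t
    refine (Finset.abs_sum_le_sum_abs _ _).trans ?_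
    simp only [abs_sg, Finset.sum_const, nsmul_eq_mul, mul_one]
    exact_mod_cast Finset.card_le_univ _
  have hYi : ∀ σ k, ∫ t, Y σ k t ∂ν = ∑ i, sg (σ i) * v k i := by
    intro σ k
    simp only [hYe]
    rw [integral_finsetSum]
    · refine Finset.sum_congr rfl fun i _ => ?_
      rw [integral_const_mul, integral_indicator measurableSet_Iio]
      congr 1
      have : Set.Iio (v k i) ∩ Set.Ico 0 1 = Set.Ico 0 (v k i) := by
        ext x
        simp only [Set.mem_inter_iff, Set.mem_Iio, Set.mem_Ico]
        exact ⟨fun h => ⟨h.2.1, h.1⟩, fun h => ⟨h.2, h.1, h.2.trans_le (h01 k i).2⟩⟩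
      simp only [ν, Measure.restrict_restrict measurableSet_Iio, this]
      simp [(h01 k i).1]
    · intro i _
      refine (Integrable.of_bound (hind k i).aestronglyMeasurable 1
        (Filter.Eventually.of_forall fun t => ?_)).const_mul _
      simp only [Set.indicator_apply]; split_ifs <;> simp
  calc _ ≤ ∑ σ : ι → Bool, ∫ t, Real.exp (τ * partialSups (fun k => Y σ k t) N) ∂ν := by
        refine Finset.sum_le_sum fun σ _ => ?_
        have := jensen ν (Y σ) (hYm σ) _ (hYb σ) τ hτ N
        simpa only [hYi] using this
    _ = ∫ t, ∑ σ : ι → Bool, Real.exp (τ * partialSups (fun k => Y σ k t) N) ∂ν := by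
        rw [integral_finsetSum]
        exact fun σ _ => integrable_exp_psups ν (Y σ) (hYm σ) _ (hYb σ) τ hτ N
    _ ≤ ∫ t, 2 ^ Fintype.card ι * (4 * Real.exp (τ ^ 2 * Fintype.card ι / 2)) ∂ν := by
        refine integral_mono (integrable_finsetSum _ fun σ _ =>
          integrable_exp_psups ν (Y σ) (hYm σ) _ (hYb σ) τ hτ N) (integrable_const _) fun t => ?_
        exact chain_sets (A t) (hA t) τ hτ N
    _ = _ := by simp

lemma chain_diff (a b : ℕ → ι → ℝ) (ha : Monotone a) (hb : Monotone b)
    (ha01 : ∀ k i, a k i ∈ Set.Icc (0:ℝ) 1) (hb01 : ∀ k i, b k i ∈ Set.Icc (0:ℝ) 1)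
    (τ : ℝ) (hτ : 0 ≤ τ) (N : ℕ) :
    ∑ σ : ι → Bool, Real.exp (τ * partialSups (fun k => ∑ i, sg (σ i) * (a k i - b k i)) N) ≤
      2 ^ Fintype.card ι * (4 * Real.exp ((2 * τ) ^ 2 * Fintype.card ι / 2)) := by
  have h1 := chain_vec a ha ha01 (2 * τ) (by positivity) N
  have h2 := chain_vec b hb hb01 (2 * τ) (by positivity) N
  rw [← sum_flip Finset.univ] at h2
  have h3 : ∑ σ : ι → Bool,
      Real.exp (τ * partialSups (fun k => ∑ i, sg (σ i) * (a k i - b k i)) N) ≤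
      ∑ σ : ι → Bool, (1 / 2) *
        (Real.exp (2 * τ * partialSups (fun k => ∑ i, sg (σ i) * a k i) N) +
        Real.exp (2 * τ * partialSups (fun k => ∑ i, sg (flip Finset.univ σ i) * b k i) N)) := by
    refine Finset.sum_le_sum fun σ _ => ?_
    set x := partialSups (fun k => ∑ i, sg (σ i) * a k i) N with hx
    set y := partialSups (fun k => ∑ i, sg (flip Finset.univ σ i) * b k i) N with hy
    have hxy : partialSups (fun k => ∑ i, sg (σ i) * (a k i - b k i)) N ≤ x + y := by
      refine partialSups_le _ _ _ fun j hj => ?_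
      have e1 := le_partialSups_of_le (fun k => ∑ i, sg (σ i) * a k i) hj
      have e2 := le_partialSups_of_le (fun k => ∑ i, sg (flip Finset.univ σ i) * b k i) hj
      refine le_trans (le_of_eq ?_) (add_le_add e1 e2)
      simp only [flip, Finset.mem_univ, if_true, sg_not]
      rw [← Finset.sum_add_distrib]
      exact Finset.sum_congr rfl fun i _ => by ring
    have e := Real.exp_le_exp.2 (mul_le_mul_of_nonneg_left hxy hτ)
    have sq : ∀ x, Real.exp (2 * τ * x) = Real.exp (τ * x) ^ 2 := by
      intro x; rw [← Real.exp_nat_mul]; congr 1; push_cast; ring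
    rw [mul_add, Real.exp_add] at e
    rw [sq, sq]
    nlinarith [sq_nonneg (Real.exp (τ * x) - Real.exp (τ * y))]
  rw [← Finset.mul_sum, Finset.sum_add_distrib] at h3
  linarith

lemma symm_bound {Θ : Type*} [MeasurableSpace Θ] (μ : Measure Θ) [IsProbabilityMeasure μ]
    (g : ℕ → Θ → ℝ) (hg : ∀ k, Measurable (g k)) (hmono : Monotone g)
    (h01 : ∀ k θ, g k θ ∈ Set.Icc (0:ℝ) 1) (s : ℕ) (τ : ℝ) (hτ : 0 ≤ τ) (N : ℕ) :
    ∫ S, Real.exp (τ * partialSups (fun k => ∑ i, (∫ θ, g k θ ∂μ - g k (S i))) N)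
      ∂(Measure.pi fun _ : Fin s => μ) ≤ 4 * Real.exp ((2 * τ) ^ 2 * s / 2) := by
  set P := Measure.pi fun _ : Fin s => μ with hP
  have habs : ∀ x ∈ Set.Icc (0:ℝ) 1, ∀ y ∈ Set.Icc (0:ℝ) 1, |x - y| ≤ 1 := by
    intro x hx y hy; rw [abs_le]; constructor <;> linarith [hx.1, hx.2, hy.1, hy.2]
  have hbd : ∀ F : Fin s → ℝ, (∀ i, |F i| ≤ 1) → |∑ i, F i| ≤ s := by
    intro F hF
    refine (Finset.abs_sum_le_sum_abs _ _).trans ((Finset.sum_le_sum fun i _ => hF i).trans ?_)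
    simp
  have hint : ∀ k, Integrable (g k) μ := fun k =>
    Integrable.of_bound (hg k).aestronglyMeasurable 1 (Filter.Eventually.of_forall fun θ => by
      rw [Real.norm_eq_abs, abs_le]; constructor <;> linarith [(h01 k θ).1, (h01 k θ).2])
  have hP01 : ∀ k, ∫ θ, g k θ ∂μ ∈ Set.Icc (0:ℝ) 1 := fun k =>
    ⟨integral_nonneg fun θ => (h01 k θ).1, by
      have := integral_mono (hint k) (integrable_const (1:ℝ)) fun θ => (h01 k θ).2
      simpa using this⟩
  let Y : ℕ → (Fin s → Θ) × (Fin s → Θ) → ℝ := fun k p => ∑ i, (g k (p.2 i) - g k (p.1 i))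
  have hYm : ∀ k, Measurable (Y k) := by
    intro k
    refine Finset.measurable_sum _ fun i _ => ?_
    exact ((hg k).comp ((measurable_pi_apply i).comp measurable_snd)).sub
      ((hg k).comp ((measurable_pi_apply i).comp measurable_fst))
  have hYb : ∀ k p, |Y k p| ≤ s := fun k p => hbd _ fun i => habs _ (h01 _ _) _ (h01 _ _)
  have hWint := integrable_exp_psups (P.prod P) Y hYm s hYb τ hτ N
  -- step 1: Jensen
  have step1 : ∫ S, Real.exp (τ * partialSups (fun k => ∑ i, (∫ θ, g k θ ∂μ - g k (S i))) N) ∂P ≤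
      ∫ p, Real.exp (τ * partialSups (fun k => Y k p) N) ∂(P.prod P) := by
    rw [integral_prod _ hWint]
    refine integral_mono ?_ hWint.integral_prod_left fun S => ?_
    · refine integrable_exp_psups P (fun k S => ∑ i, (∫ θ, g k θ ∂μ - g k (S i)))
        (fun k => Finset.measurable_sum _ fun i _ => measurable_const.sub
          ((hg k).comp (measurable_pi_apply i))) s
        (fun k S => hbd _ fun i => habs _ (hP01 _) _ (h01 _ _)) τ hτ N
    · have := jensen P (fun k S' => Y k (S, S'))
        (fun k => (hYm k).comp measurable_prodMk_left) s (fun k S' => hYb k _) τ hτ N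
      refine le_trans (le_of_eq ?_) this
      have e : ∀ k, ∑ i, (∫ θ, g k θ ∂μ - g k (S i)) = ∫ S', Y k (S, S') ∂P := by
        intro k
        have hi : ∀ i : Fin s, Integrable (fun S' : Fin s → Θ => g k (S' i)) P := fun i =>
          (measurePreserving_eval (fun _ : Fin s => μ) i).integrable_comp_of_integrable (hint k)
        simp only [Y]
        rw [integral_finsetSum (f := fun i (S' : Fin s → Θ) => g k (S' i) - g k (S i)) _
          fun i _ => (hi i).sub (integrable_const _)]
        refine Finset.sum_congr rfl fun i _ => ?_
        rw [integral_sub (hi i) (integrable_const _)]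
        rw [hP, integral_comp_eval (μ := fun _ : Fin s => μ) (i := i) (f := g k)
          (hg k).aestronglyMeasurable]
        simp
      simp only [e]
  refine step1.trans ?_
  -- step 2 : pair up
  set Q := Measure.pi fun _ : Fin s => μ.prod μ with hQ
  have step2 : ∫ p, Real.exp (τ * partialSups (fun k => Y k p) N) ∂(P.prod P) =
      ∫ z, Real.exp (τ * partialSups (fun k => ∑ i, (g k (z i).2 - g k (z i).1)) N) ∂Q := by
    have := (measurePreserving_arrowProdEquivProdArrow Θ Θ (Fin s) (fun _ => μ)
      (fun _ => μ)).integral_comp' (fun p => Real.exp (τ * partialSups (fun k => Y k p) N))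
    rw [← this]
    rfl
  rw [step2]
  let Z : (Fin s → Bool) → ℕ → (Fin s → Θ × Θ) → ℝ := fun σ k z =>
    ∑ i, sg (σ i) * (g k (z i).2 - g k (z i).1)
  have hZm : ∀ σ k, Measurable (Z σ k) := by
    intro σ k
    refine Finset.measurable_sum _ fun i _ => Measurable.const_mul ?_ _
    exact ((hg k).comp (measurable_snd.comp (measurable_pi_apply i))).sub
      ((hg k).comp (measurable_fst.comp (measurable_pi_apply i)))
  have hZb : ∀ σ k z, |Z σ k z| ≤ s := fun σ k z => hbd _ fun i => by
    rw [abs_mul, abs_sg, one_mul]; exact habs _ (h01 _ _) _ (h01 _ _)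
  have hZint := fun σ => integrable_exp_psups Q (Z σ) (hZm σ) s (hZb σ) τ hτ N
  have step3 : ∀ σ : Fin s → Bool,
      ∫ z, Real.exp (τ * partialSups (fun k => ∑ i, (g k (z i).2 - g k (z i).1)) N) ∂Q =
      ∫ z, Real.exp (τ * partialSups (fun k => Z σ k z) N) ∂Q := by
    intro σ
    let φ : Fin s → Θ × Θ → Θ × Θ := fun i p => if σ i then p else p.swap
    have hφ : ∀ i, MeasurePreserving (φ i) (μ.prod μ) (μ.prod μ) := by
      intro i
      by_cases h : σ i
      · simp only [φ, h, if_true]; exact MeasurePreserving.id _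
      · simp only [φ, h]; exact Measure.measurePreserving_swap
    have hpi := measurePreserving_pi (fun _ : Fin s => μ.prod μ) (fun _ : Fin s => μ.prod μ) hφ
    rw [← hQ] at hpi
    have hm : Measurable fun z : Fin s → Θ × Θ =>
        Real.exp (τ * partialSups (fun k => ∑ i, (g k (z i).2 - g k (z i).1)) N) := by
      have := hZm (fun _ => true)
      simp only [Z, sg, if_true, one_mul] at this
      exact Real.measurable_exp.comp ((measurable_psups _ this N).const_mul τ)
    conv_lhs => rw [← hpi.map_eq]
    rw [integral_map hpi.measurable.aemeasurable hm.aestronglyMeasurable]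
    refine integral_congr_ae (Filter.Eventually.of_forall fun z => ?_)
    have e : ∀ k, ∑ i, (g k (φ i (z i)).2 - g k (φ i (z i)).1) = Z σ k z := by
      intro k
      refine Finset.sum_congr rfl fun i _ => ?_
      by_cases h : σ i <;> simp [φ, h, sg]
    simp only [e]
  set I := ∫ z, Real.exp (τ * partialSups (fun k => ∑ i, (g k (z i).2 - g k (z i).1)) N) ∂Q
  have step4 : (2:ℝ) ^ s * I ≤ 2 ^ s * (4 * Real.exp ((2 * τ) ^ 2 * s / 2)) := by
    calc (2:ℝ) ^ s * I = ∑ σ : Fin s → Bool, I := by simp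
      _ = ∑ σ : Fin s → Bool, ∫ z, Real.exp (τ * partialSups (fun k => Z σ k z) N) ∂Q :=
          Finset.sum_congr rfl fun σ _ => step3 σ
      _ = ∫ z, ∑ σ : Fin s → Bool, Real.exp (τ * partialSups (fun k => Z σ k z) N) ∂Q := by
          rw [integral_finsetSum _ fun σ _ => hZint σ]
      _ ≤ ∫ z, 2 ^ s * (4 * Real.exp ((2 * τ) ^ 2 * s / 2)) ∂Q := by
          refine integral_mono (integrable_finsetSum _ fun σ _ => hZint σ)
            (integrable_const _) fun z => ?_
          have := chain_diff (fun k i => g k (z i).2) (fun k i => g k (z i).1)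
            (fun k l h i => hmono h _) (fun k l h i => hmono h _)
            (fun k i => h01 _ _) (fun k i => h01 _ _) τ hτ N
          simpa using this
      _ = _ := by simp
  exact le_of_mul_le_mul_left step4 (by positivity)

lemma one_sided {Θ : Type*} [MeasurableSpace Θ] (μ : Measure Θ) [IsProbabilityMeasure μ]
    (g : ℕ → Θ → ℝ) (hg : ∀ k, Measurable (g k)) (hmono : Monotone g)
    (h01 : ∀ k θ, g k θ ∈ Set.Icc (0:ℝ) 1) (s : ℕ) (ε : ℝ) (hε : 0 < ε) (N : ℕ) :
    (Measure.pi fun _ : Fin s => μ).real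
      {S | ∃ k ≤ N, s * ε ≤ ∑ i, (∫ θ, g k θ ∂μ - g k (S i))} ≤
      4 * Real.exp (- (s * ε ^ 2 / 8)) := by
  set P := Measure.pi fun _ : Fin s => μ with hP
  set τ := ε / 4 with hτ
  have h1 := symm_bound μ g hg hmono h01 s τ (by positivity) N
  rw [← hP] at h1
  have hint : ∀ k, Integrable (g k) μ := fun k =>
    Integrable.of_bound (hg k).aestronglyMeasurable 1 (Filter.Eventually.of_forall fun θ => by
      rw [Real.norm_eq_abs, abs_le]; constructor <;> linarith [(h01 k θ).1, (h01 k θ).2])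
  have hP01 : ∀ k, ∫ θ, g k θ ∂μ ∈ Set.Icc (0:ℝ) 1 := fun k =>
    ⟨integral_nonneg fun θ => (h01 k θ).1, by
      have := integral_mono (hint k) (integrable_const (1:ℝ)) fun θ => (h01 k θ).2
      simpa using this⟩
  have hInt : Integrable (fun S : Fin s → Θ =>
      Real.exp (τ * partialSups (fun k => ∑ i, (∫ θ, g k θ ∂μ - g k (S i))) N)) P := by
    refine integrable_exp_psups P (fun k S => ∑ i, (∫ θ, g k θ ∂μ - g k (S i)))
        (fun k => Finset.measurable_sum _ fun i _ => measurable_const.sub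
          ((hg k).comp (measurable_pi_apply i))) s
        (fun k S => ?_) τ (by positivity) N
    refine (Finset.abs_sum_le_sum_abs _ _).trans
      ((Finset.sum_le_sum (g := fun _ => (1:ℝ)) fun i _ => ?_).trans (by simp))
    rw [abs_le]
    constructor <;> linarith [(hP01 k).1, (hP01 k).2, (h01 k (S i)).1, (h01 k (S i)).2]
  have h2 := mul_meas_ge_le_integral_of_nonneg
    (Filter.Eventually.of_forall fun S => (Real.exp_pos _).le) hInt (Real.exp (τ * (s * ε)))
  have h3 : P.real {S | ∃ k ≤ N, s * ε ≤ ∑ i, (∫ θ, g k θ ∂μ - g k (S i))} ≤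
      P.real {S | Real.exp (τ * (s * ε)) ≤
        Real.exp (τ * partialSups (fun k => ∑ i, (∫ θ, g k θ ∂μ - g k (S i))) N)} := by
    refine measureReal_mono ?_
    rintro S ⟨k, hk, h⟩
    refine Real.exp_le_exp.2 (mul_le_mul_of_nonneg_left (h.trans ?_) (by positivity))
    exact le_partialSups_of_le (fun k => ∑ i, (∫ θ, g k θ ∂μ - g k (S i))) hk
  refine h3.trans ?_
  have h4 : 4 * Real.exp (- (s * ε ^ 2 / 8)) =
      (4 * Real.exp ((2 * τ) ^ 2 * s / 2)) / Real.exp (τ * (s * ε)) := by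
    rw [mul_div_assoc (4:ℝ) (Real.exp _), ← Real.exp_sub]
    congr 2
    rw [hτ]; ring
  rw [h4, le_div_iff₀ (Real.exp_pos _), mul_comm]
  exact h2.trans h1

lemma two_sided {Θ : Type*} [MeasurableSpace Θ] (μ : Measure Θ) [IsProbabilityMeasure μ]
    (g : ℕ → Θ → ℝ) (hg : ∀ k, Measurable (g k)) (hmono : Monotone g)
    (h01 : ∀ k θ, g k θ ∈ Set.Icc (0:ℝ) 1) (s : ℕ) (ε : ℝ) (hε : 0 < ε) (N : ℕ) :
    (Measure.pi fun _ : Fin s => μ).real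
      {S | ∃ k ≤ N, s * ε ≤ |∑ i, (∫ θ, g k θ ∂μ - g k (S i))|} ≤
      8 * Real.exp (- (s * ε ^ 2 / 8)) := by
  have h1 := one_sided μ g hg hmono h01 s ε hε N
  have h2 := one_sided μ (fun k θ => 1 - g (N - k) θ) (fun k => measurable_const.sub (hg _))
    (fun k l h θ => sub_le_sub_left (hmono (Nat.sub_le_sub_left h N) θ) _)
    (fun k θ => ⟨by linarith [(h01 (N-k) θ).2], by linarith [(h01 (N-k) θ).1]⟩) s ε hε N
  have hint : ∀ k, Integrable (g k) μ := fun k =>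
    Integrable.of_bound (hg k).aestronglyMeasurable 1 (Filter.Eventually.of_forall fun θ => by
      rw [Real.norm_eq_abs, abs_le]; constructor <;> linarith [(h01 k θ).1, (h01 k θ).2])
  refine (measureReal_mono (s₂ := {S | ∃ k ≤ N, s * ε ≤ ∑ i, (∫ θ, g k θ ∂μ - g k (S i))} ∪
    {S | ∃ k ≤ N, s * ε ≤ ∑ i, (∫ θ, (1 - g (N - k) θ) ∂μ - (1 - g (N - k) (S i)))}) ?_).trans
    ((measureReal_union_le _ _).trans (by linarith))
  rintro S ⟨k, hk, h⟩
  rcases le_abs.1 h with h | h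
  · exact Or.inl ⟨k, hk, h⟩
  · refine Or.inr ⟨N - k, Nat.sub_le _ _, h.trans (le_of_eq ?_)⟩
    rw [Nat.sub_sub_self hk, integral_sub (integrable_const _) (hint k), ← Finset.sum_neg_distrib]
    refine Finset.sum_congr rfl fun i _ => ?_
    simp

end UCLC

/-- Uniform convergence for linear contracts: with `s ≥ 3456 ln(4/δ)/ε²` i.i.d.
samples from a distribution `μ` over agent types, with probability at least
`1-δ`, simultaneously for all `α ∈ [0,1]`, `|U_p(𝒟,α) - U_p(S,α)| ≤ ε`, where
`u_p(θ,α) = (1-α) ∑ⱼ f θ (astar θ α) j * r j`. -/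
theorem uniform_convergence_linear_contracts
    (n m : ℕ) (hn : 0 < n) (hm : 2 ≤ m)
    (r : Fin m → ℝ) (hr : ∀ j, r j ∈ Set.Icc (0:ℝ) 1)
    (Θ : Type*) [MeasurableSpace Θ] (μ : Measure Θ) [IsProbabilityMeasure μ]
    (f : Θ → Fin n → Fin m → ℝ) (c : Θ → Fin n → ℝ)
    (hf_nonneg : ∀ θ a j, 0 ≤ f θ a j) (hf_sum : ∀ θ a, ∑ j, f θ a j = 1)
    (hc_nonneg : ∀ θ a, 0 ≤ c θ a) (hc_zero : ∀ θ, c θ ⟨0, hn⟩ = 0)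
    (astar : Θ → ℝ → Fin n)
    (h_best : ∀ θ : Θ, ∀ α : ℝ, ∀ a : Fin n,
      (∑ j, f θ a j * (α * r j)) - c θ a ≤
        (∑ j, f θ (astar θ α) j * (α * r j)) - c θ (astar θ α))
    (h_tie : ∀ θ : Θ, ∀ α : ℝ, ∀ a : Fin n,
      (∑ j, f θ a j * (α * r j)) - c θ a =
        (∑ j, f θ (astar θ α) j * (α * r j)) - c θ (astar θ α) →
      ∑ j, f θ a j * r j ≤ ∑ j, f θ (astar θ α) j * r j)
    (hmeas : ∀ α : ℝ, Measurable fun θ => ∑ j, f θ (astar θ α) j * r j)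
    (s : ℕ) (ε δ : ℝ) (hε : 0 < ε) (hδ : δ ∈ Set.Ioo (0:ℝ) 1)
    (hs : 3456 * Real.log (4 / δ) / ε ^ 2 ≤ (s : ℝ)) :
    ENNReal.ofReal (1 - δ) ≤
      Measure.pi (fun _ : Fin s => μ)
        {S : Fin s → Θ | ∀ α ∈ Set.Icc (0:ℝ) 1,
          |(∫ θ, (1 - α) * ∑ j, f θ (astar θ α) j * r j ∂μ) -
            (1 / (s:ℝ)) * ∑ i, (1 - α) * ∑ j, f (S i) (astar (S i) α) j * r j| ≤ ε} := by
  set g : ℝ → Θ → ℝ := fun α θ => ∑ j, f θ (astar θ α) j * r j with hgdef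
  have hlin : ∀ θ a α, ∑ j, f θ a j * (α * r j) = α * ∑ j, f θ a j * r j := by
    intro θ a α
    rw [Finset.mul_sum]
    exact Finset.sum_congr rfl fun j _ => by ring
  simp only [hlin] at h_best h_tie
  have hmono : Monotone g := by
    intro α β hαβ θ
    rcases hαβ.eq_or_lt with rfl | hlt
    · exact le_rfl
    have h1 := h_best θ α (astar θ β)
    have h2 := h_best θ β (astar θ α)
    change ∑ j, f θ (astar θ α) j * r j ≤ ∑ j, f θ (astar θ β) j * r j
    by_contra hcon
    push Not at hcon
    nlinarith [mul_pos (sub_pos.2 hlt) (sub_pos.2 hcon)]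
  have h01 : ∀ α θ, g α θ ∈ Set.Icc (0:ℝ) 1 := by
    intro α θ
    refine ⟨Finset.sum_nonneg fun j _ => mul_nonneg (hf_nonneg _ _ _) (hr j).1, ?_⟩
    rw [← hf_sum θ (astar θ α)]
    exact Finset.sum_le_sum fun j _ => mul_le_of_le_one_right (hf_nonneg _ _ _) (hr j).2
  have hrc : ∀ θ α, ∀ᶠ β in nhdsWithin α (Set.Ioi α), g β θ = g α θ := by
    intro θ α
    have hall : ∀ a : Fin n, ∀ᶠ β in nhdsWithin α (Set.Ioi α),
        g α θ < ∑ j, f θ a j * r j →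
        β * (∑ j, f θ a j * r j) - c θ a <
          β * (∑ j, f θ (astar θ α) j * r j) - c θ (astar θ α) := by
      intro a
      by_cases ha : g α θ < ∑ j, f θ a j * r j
      · have hst : α * (∑ j, f θ a j * r j) - c θ a <
            α * (∑ j, f θ (astar θ α) j * r j) - c θ (astar θ α) := by
          refine lt_of_le_of_ne (h_best θ α a) fun he => ?_
          exact absurd (h_tie θ α a he) (not_le.2 ha)
        have hev : ∀ᶠ β in nhds α, β * (∑ j, f θ a j * r j) - c θ a <
            β * (∑ j, f θ (astar θ α) j * r j) - c θ (astar θ α) := by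
          refine ContinuousAt.eventually_lt ?_ ?_ hst <;> fun_prop
        filter_upwards [hev.filter_mono nhdsWithin_le_nhds] with β hβ _ using hβ
      · exact Filter.Eventually.of_forall fun β h => absurd h ha
    filter_upwards [Filter.eventually_all.2 hall, self_mem_nhdsWithin] with β hβ hlt
    refine le_antisymm ?_ (hmono (le_of_lt hlt) θ)
    by_contra hcon
    push Not at hcon
    exact absurd (h_best θ β (astar θ α)) (not_le.2 (hβ (astar θ β) hcon))
  have hLpos : 0 < Real.log (4 / δ) := by
    apply Real.log_pos
    rw [lt_div_iff₀ hδ.1]; linarith [hδ.2]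
  have hspos : (0:ℝ) < s := lt_of_lt_of_le (by positivity) hs
  set P := Measure.pi (fun _ : Fin s => μ) with hP
  let B : ℕ → Set (Fin s → Θ) := fun N =>
    {S | ∃ k ≤ 2 ^ (N + 1), s * ε ≤ |∑ i, (∫ θ, g ((k:ℕ) / 2 ^ N) θ ∂μ - g ((k:ℕ) / 2 ^ N) (S i))|}
  have hB : ∀ N, P (B N) ≤ ENNReal.ofReal δ := by
    intro N
    have h := UCLC.two_sided μ (fun k => g ((k:ℕ) / 2 ^ N)) (fun k => hmeas _)
      (fun k l hkl => hmono (by gcongr)) (fun k θ => h01 _ θ) s ε hε (2 ^ (N + 1))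
    rw [← ENNReal.ofReal_toReal (measure_ne_top P (B N))]
    refine ENNReal.ofReal_le_ofReal (h.trans ?_)
    rw [div_le_iff₀ (by positivity)] at hs
    have h1 : Real.exp (-(s * ε ^ 2 / 8)) ≤ Real.exp (-Real.log (4 / δ) + -Real.log (4 / δ)) :=
      Real.exp_le_exp.2 (by linarith)
    rw [Real.exp_add, Real.exp_neg (Real.log _), Real.exp_log (by have := hδ.1; positivity), inv_div] at h1
    nlinarith [hδ.1, hδ.2]
  have hBmono : Monotone B := by
    refine monotone_nat_of_le_succ fun N => ?_
    rintro S ⟨k, hk, h⟩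
    refine ⟨2 * k, by rw [pow_succ 2 (N + 1)]; omega, ?_⟩
    have e : (((2 * k : ℕ) : ℝ) / 2 ^ (N + 1)) = (k:ℝ) / 2 ^ N := by
      push_cast; rw [pow_succ]; field_simp
    rw [e]; exact h
  have hU : P (⋃ N, B N) ≤ ENNReal.ofReal δ := by
    rw [hBmono.measure_iUnion]; exact iSup_le hB
  set T := {S : Fin s → Θ | ∀ α ∈ Set.Icc (0:ℝ) 1,
          |(∫ θ, (1 - α) * ∑ j, f θ (astar θ α) j * r j ∂μ) -
            (1 / (s:ℝ)) * ∑ i, (1 - α) * ∑ j, f (S i) (astar (S i) α) j * r j| ≤ ε} with hT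
  have hsub : Tᶜ ⊆ ⋃ N, B N := by
    rw [Set.compl_subset_comm]
    intro S hS α hα
    simp only [Set.compl_iUnion, Set.mem_iInter, Set.mem_compl_iff] at hS
    let b : ℕ → ℝ := fun N => ((⌊α * 2 ^ N⌋₊ + 1 : ℕ) : ℝ) / 2 ^ N
    have hb1 : ∀ N, α < b N := by
      intro N
      rw [lt_div_iff₀ (by positivity)]
      push_cast
      exact Nat.lt_floor_add_one _
    have hb2 : ∀ N, b N ≤ α + (1 / 2) ^ N := by
      intro N
      rw [div_le_iff₀ (by positivity), add_mul, ← mul_pow]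
      have := Nat.floor_le (a := α * 2 ^ N) (mul_nonneg hα.1 (by positivity))
      push_cast
      norm_num
      linarith
    have hbt : Filter.Tendsto b Filter.atTop (nhdsWithin α (Set.Ioi α)) := by
      refine tendsto_nhdsWithin_iff.2 ⟨?_, Filter.Eventually.of_forall hb1⟩
      refine tendsto_of_tendsto_of_tendsto_of_le_of_le tendsto_const_nhds ?_
        (fun N => (hb1 N).le) hb2
      have := (tendsto_pow_atTop_nhds_zero_of_lt_one (r := (1/2:ℝ)) (by norm_num)
        (by norm_num)).const_add α
      simpa using this
    have hlim : ∀ θ, Filter.Tendsto (fun N => g (b N) θ) Filter.atTop (nhds (g α θ)) := fun θ =>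
      tendsto_const_nhds.congr' ((hbt.eventually (hrc θ α)).mono fun N h => h.symm)
    have hlimI : Filter.Tendsto (fun N => ∫ θ, g (b N) θ ∂μ) Filter.atTop
        (nhds (∫ θ, g α θ ∂μ)) := by
      refine tendsto_integral_of_dominated_convergence (fun _ => (1:ℝ))
        (fun N => (hmeas _).aestronglyMeasurable) (integrable_const _) ?_
        (Filter.Eventually.of_forall hlim)
      intro N
      refine Filter.Eventually.of_forall fun θ => ?_
      rw [Real.norm_eq_abs, abs_le]
      constructor <;> linarith [(h01 (b N) θ).1, (h01 (b N) θ).2]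
    have hle : ∀ N, |∑ i, (∫ θ, g (b N) θ ∂μ - g (b N) (S i))| ≤ s * ε := by
      intro N
      by_contra hcon
      push Not at hcon
      refine hS N ⟨⌊α * 2 ^ N⌋₊ + 1, ?_, hcon.le⟩
      have h1 : ⌊α * 2 ^ N⌋₊ ≤ 2 ^ N := by
        refine Nat.floor_le_of_le ?_
        push_cast
        exact mul_le_of_le_one_left (by positivity) hα.2
      have h2 : 1 ≤ 2 ^ N := Nat.one_le_two_pow
      rw [pow_succ]; omega
    have hfin : |∑ i, (∫ θ, g α θ ∂μ - g α (S i))| ≤ s * ε := by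
      refine le_of_tendsto' (Filter.Tendsto.abs (tendsto_finsetSum _ fun i _ =>
        hlimI.sub (hlim (S i)))) hle
    have hrew : (∫ θ, (1 - α) * g α θ ∂μ) - (1 / (s:ℝ)) * ∑ i, (1 - α) * g α (S i) =
        ((1 - α) / s) * ∑ i, (∫ θ, g α θ ∂μ - g α (S i)) := by
      rw [integral_const_mul, ← Finset.mul_sum, Finset.sum_sub_distrib]
      simp only [Finset.sum_const, Finset.card_univ, Fintype.card_fin, nsmul_eq_mul]
      field_simp
    change |(∫ θ, (1 - α) * g α θ ∂μ) - (1 / (s:ℝ)) * ∑ i, (1 - α) * g α (S i)| ≤ ε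
    rw [hrew, abs_mul, abs_of_nonneg (div_nonneg (by linarith [hα.2]) hspos.le)]
    calc (1 - α) / s * |∑ i, (∫ θ, g α θ ∂μ - g α (S i))| ≤ (1 - α) / s * (s * ε) :=
          mul_le_mul_of_nonneg_left hfin (div_nonneg (by linarith [hα.2]) hspos.le)
      _ = (1 - α) * ε := by field_simp
      _ ≤ ε := mul_le_of_le_one_left hε.le (by linarith [hα.1])
  rw [ENNReal.ofReal_sub _ hδ.1.le, ENNReal.ofReal_one, tsub_le_iff_right]
  calc (1 : ENNReal) = P Set.univ := by simp [P]
    _ = P (T ∪ Tᶜ) := by rw [Set.union_compl_self]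
    _ ≤ P T + P Tᶜ := measure_union_le _ _
    _ ≤ P T + ENNReal.ofReal δ := by gcongr; exact (measure_mono hsub).trans hU
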